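/- In the finite MFG with separable cost c_{xy}(p,M) = K(x,y,p) + f(x,M), if f and g are monotone, then the function F(P,η) := J_{M_η}(P) is monotone, i.e. ∫_{K_{S,T}} (F(P,η) − F(P,η')) d(η − η')(P) ≥ 0 for all Borel probability measures η, η' on K_{S,T}. -/

import Mathlib

open MeasureTheory Filter Topology

noncomputable section

/-- The simplex of probability vectors on a finite set `S`. -/
def simplex (S : Type*) [Fintype S] : Set (S → ℝ) :=
  {p | (∀ x, 0 ≤ p x) ∧ ∑ x, p x = 1}

/-- The set of transition kernels on `S` with time horizon `N`. -/
def kernels (S : Type*) [Fintype S] (N : ℕ) : Set (S → S → Fin N → ℝ) :=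
  {P | ∀ x k, (fun y => P x y k) ∈ simplex S}

/-- The marginal flow `M_P^{M₀}`. -/
def flow {S : Type*} [Fintype S] {N : ℕ} (M0 : S → ℝ) (P : S → S → Fin N → ℝ) :
    ℕ → S → ℝ
  | 0 => M0
  | k + 1 => fun x =>
      if h : k < N then ∑ y, flow M0 P k y * P y x ⟨k, h⟩ else flow M0 P k x

/-- The cost functional `J_M(P)` of the finite MFG. -/
def Jcost {S : Type*} [Fintype S] {N : ℕ}
    (c : S → S → (S → ℝ) → (S → ℝ) → ℝ) (g : S → (S → ℝ) → ℝ) (M0 : S → ℝ)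
    (M : ℕ → S → ℝ) (P : S → S → Fin N → ℝ) : ℝ :=
  (∑ k : Fin N, ∑ x, ∑ y,
      flow M0 P (k : ℕ) x * P x y k * c x y (fun z => P x z k) (M (k : ℕ))) +
    ∑ x, flow M0 P N x * g x (M N)

/-- The averaged marginal flow `M_η(k) = ∫ M_P^{M₀}(·,k) dη(P)`. -/
def avgFlow {S : Type*} [Fintype S] {N : ℕ} (M0 : S → ℝ)
    (η : Measure (S → S → Fin N → ℝ)) (k : ℕ) : S → ℝ :=
  fun x => ∫ P, flow M0 P k x ∂η

/-- `F(P, η) := J_{M_η}(P)`. -/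
def Fmfg {S : Type*} [Fintype S] {N : ℕ}
    (c : S → S → (S → ℝ) → (S → ℝ) → ℝ) (g : S → (S → ℝ) → ℝ) (M0 : S → ℝ)
    (P : S → S → Fin N → ℝ) (η : Measure (S → S → Fin N → ℝ)) : ℝ :=
  Jcost c g M0 (fun k => avgFlow M0 η k) P

/-- A function `h : S × P(S) → ℝ` is monotone. -/
def IsMonotoneCoupling {S : Type*} [Fintype S] (h : S → (S → ℝ) → ℝ) : Prop :=
  ∀ M ∈ simplex S, ∀ M' ∈ simplex S, 0 ≤ ∑ x, (h x M - h x M') * (M x - M' x)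

lemma flow_mem_simplex {S : Type*} [Fintype S] {N : ℕ} {M0 : S → ℝ} (hM0 : M0 ∈ simplex S)
    {P : S → S → Fin N → ℝ} (hP : P ∈ kernels S N) (k : ℕ) : flow M0 P k ∈ simplex S := by
  induction k with
  | zero => exact hM0
  | succ k ih =>
    by_cases h : k < N
    · refine ⟨fun x => ?_, ?_⟩
      · simp only [flow, h, dif_pos]
        exact Finset.sum_nonneg fun y _ => mul_nonneg (ih.1 y) ((hP y ⟨k, h⟩).1 x)
      · simp only [flow, h, dif_pos]
        rw [Finset.sum_comm]
        simp_rw [← Finset.mul_sum]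
        rw [← ih.2]
        exact Finset.sum_congr rfl fun y _ => by rw [(hP y ⟨k, h⟩).2, mul_one]
    · have : flow M0 P (k + 1) = flow M0 P k := by
        funext x
        simp [flow, h]
      rwa [this]

lemma continuous_flow {S : Type*} [Fintype S] {N : ℕ} (M0 : S → ℝ) (k : ℕ) (x : S) :
    Continuous fun P : S → S → Fin N → ℝ => flow M0 P k x := by
  induction k generalizing x with
  | zero => exact continuous_const
  | succ k ih =>
    by_cases h : k < N
    · simp only [flow, h, dif_pos]
      exact continuous_finsetSum _ fun y _ => (ih y).mul (by fun_prop)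
    · simpa only [flow, h, dif_neg, not_false_iff] using ih x

lemma integrable_flow {S : Type*} [Fintype S] {N : ℕ} {M0 : S → ℝ} (hM0 : M0 ∈ simplex S)
    {η : Measure (S → S → Fin N → ℝ)} [IsProbabilityMeasure η]
    (hη : ∀ᵐ P ∂η, P ∈ kernels S N) (k : ℕ) (x : S) :
    Integrable (fun P => flow M0 P k x) η := by
  refine Integrable.of_bound (continuous_flow M0 k x).measurable.aestronglyMeasurable 1 ?_
  filter_upwards [hη] with P hP
  have h := flow_mem_simplex hM0 hP k
  rw [Real.norm_of_nonneg (h.1 x), ← h.2]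
  exact Finset.single_le_sum (fun y _ => h.1 y) (Finset.mem_univ x)

lemma avgFlow_mem_simplex {S : Type*} [Fintype S] {N : ℕ} {M0 : S → ℝ} (hM0 : M0 ∈ simplex S)
    {η : Measure (S → S → Fin N → ℝ)} [IsProbabilityMeasure η]
    (hη : ∀ᵐ P ∂η, P ∈ kernels S N) (k : ℕ) : avgFlow M0 η k ∈ simplex S := by
  refine ⟨fun x => integral_nonneg_of_ae ?_, ?_⟩
  · filter_upwards [hη] with P hP using (flow_mem_simplex hM0 hP k).1 x
  · simp only [avgFlow]
    rw [← integral_finsetSum _ fun x _ => integrable_flow hM0 hη k x]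
    have : ∀ᵐ P ∂η, ∑ x, flow M0 P k x = 1 := by
      filter_upwards [hη] with P hP using (flow_mem_simplex hM0 hP k).2
    simp [integral_congr_ae this]

/-- For a separable cost, the difference of costs under two flows does not involve the
running cost `K`. -/
lemma Jcost_sub_Jcost {S : Type*} [Fintype S] {N : ℕ}
    {c : S → S → (S → ℝ) → (S → ℝ) → ℝ} {K : S → S → (S → ℝ) → ℝ}
    {f : S → (S → ℝ) → ℝ} (g : S → (S → ℝ) → ℝ)
    (hsep : ∀ x y p M, c x y p M = K x y p + f x M) (M0 : S → ℝ) (M M' : ℕ → S → ℝ)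
    {P : S → S → Fin N → ℝ} (hP : P ∈ kernels S N) :
    Jcost c g M0 M P - Jcost c g M0 M' P =
      (∑ k : Fin N, ∑ x, flow M0 P k x * (f x (M k) - f x (M' k))) +
        ∑ x, flow M0 P N x * (g x (M N) - g x (M' N)) := by
  simp only [Jcost]
  rw [add_sub_add_comm]
  simp only [← Finset.sum_sub_distrib]
  congr 1
  · refine Finset.sum_congr rfl fun k _ => Finset.sum_congr rfl fun x _ => ?_
    calc _ = ∑ y, P x y k * (flow M0 P k x * (f x (M k) - f x (M' k))) :=
          Finset.sum_congr rfl fun y _ => by rw [hsep, hsep]; ring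
      _ = _ := by rw [← Finset.sum_mul, (hP x k).2, one_mul]
  · exact Finset.sum_congr rfl fun x _ => by ring

lemma integral_Fmfg_sub_Fmfg {S : Type*} [Fintype S] {N : ℕ}
    {c : S → S → (S → ℝ) → (S → ℝ) → ℝ} {K : S → S → (S → ℝ) → ℝ}
    {f : S → (S → ℝ) → ℝ} (g : S → (S → ℝ) → ℝ)
    (hsep : ∀ x y p M, c x y p M = K x y p + f x M)
    {M0 : S → ℝ} (hM0 : M0 ∈ simplex S) (η η' : Measure (S → S → Fin N → ℝ))
    {ν : Measure (S → S → Fin N → ℝ)} [IsProbabilityMeasure ν]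
    (hν : ∀ᵐ P ∂ν, P ∈ kernels S N) :
    ∫ P, (Fmfg c g M0 P η - Fmfg c g M0 P η') ∂ν =
      (∑ k : Fin N, ∑ x,
        avgFlow M0 ν k x * (f x (avgFlow M0 η k) - f x (avgFlow M0 η' k))) +
        ∑ x, avgFlow M0 ν N x * (g x (avgFlow M0 η N) - g x (avgFlow M0 η' N)) := by
  have hint (k : ℕ) (x : S) (a : ℝ) : Integrable (fun P => flow M0 P k x * a) ν :=
    (integrable_flow hM0 hν k x).mul_const a
  simp only [Fmfg]
  rw [integral_congr_ae (hν.mono fun P hP =>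
    Jcost_sub_Jcost g hsep M0 (avgFlow M0 η) (avgFlow M0 η') hP)]
  rw [integral_add
    (integrable_finsetSum _ fun k _ => integrable_finsetSum _ fun x _ => hint _ _ _)
    (integrable_finsetSum _ fun x _ => hint _ _ _)]
  rw [integral_finsetSum _ fun k _ => integrable_finsetSum _ fun x _ => hint _ _ _,
    integral_finsetSum _ fun x _ => hint _ _ _]
  simp_rw [integral_finsetSum Finset.univ fun x _ => hint _ x _, integral_mul_const]
  rfl

/-- If in the finite MFG with separable cost `c_{xy}(p,M) = K(x,y,p) + f(x,M)` the
couplings `f` and `g` are monotone, then `F(P,η) = J_{M_η}(P)` is monotone: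
`∫ (F(P,η) − F(P,η')) d(η − η')(P) ≥ 0`. -/
theorem Fmfg_monotone {S : Type*} [Fintype S] [Nonempty S] (N : ℕ)
    (c : S → S → (S → ℝ) → (S → ℝ) → ℝ) (K : S → S → (S → ℝ) → ℝ)
    (f : S → (S → ℝ) → ℝ) (g : S → (S → ℝ) → ℝ)
    (hsep : ∀ x y p M, c x y p M = K x y p + f x M)
    (hf : IsMonotoneCoupling f) (hg : IsMonotoneCoupling g)
    (M0 : S → ℝ) (hM0 : M0 ∈ simplex S)
    (η η' : Measure (S → S → Fin N → ℝ))
    (hη : IsProbabilityMeasure η) (hη' : IsProbabilityMeasure η')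
    (hηsupp : η (kernels S N)ᶜ = 0) (hη'supp : η' (kernels S N)ᶜ = 0) :
    0 ≤ (∫ P, (Fmfg c g M0 P η - Fmfg c g M0 P η') ∂η) -
        ∫ P, (Fmfg c g M0 P η - Fmfg c g M0 P η') ∂η' := by
  rw [integral_Fmfg_sub_Fmfg g hsep hM0 η η' hηsupp,
    integral_Fmfg_sub_Fmfg g hsep hM0 η η' hη'supp, add_sub_add_comm]
  simp only [← Finset.sum_sub_distrib]
  refine add_nonneg (Finset.sum_nonneg fun k _ => ?_) ?_
  · refine (hf _ (avgFlow_mem_simplex hM0 hηsupp k) _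
      (avgFlow_mem_simplex hM0 hη'supp k)).trans_eq ?_
    exact Finset.sum_congr rfl fun x _ => by ring
  · refine (hg _ (avgFlow_mem_simplex hM0 hηsupp N) _
      (avgFlow_mem_simplex hM0 hη'supp N)).trans_eq ?_
    exact Finset.sum_congr rfl fun x _ => by ring
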